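/- Let n ≥ 2 be an integer and p a prime. Then S_n(p) = p²·W_n(p) − ((p−1)^{n−1} + (−1)^n). -/

import Mathlib

open Finset

/-- The Kloosterman sum `K(u,v;q) = ∑_{x ∈ (ℤ/qℤ)^*} e^{2πi(ux + v x̄)/q}`. -/
noncomputable def Kl (q : ℕ) (u v : ℤ) : ℂ :=
  ∑ x ∈ Finset.range q,
    if Nat.Coprime x q then
      Complex.exp (2 * Real.pi * Complex.I *
        ((u : ℂ) * (x : ℂ) + (v : ℂ) * ((((x : ZMod q)⁻¹ : ZMod q).val : ℕ) : ℂ)) / (q : ℂ))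
    else 0

/-- The `n`-th power moment `S_n(q) = ∑_{u=1}^q K(u,1;q)^n`. -/
noncomputable def S (n q : ℕ) : ℂ :=
  ∑ u ∈ Finset.range q, Kl q ((u : ℤ) + 1) 1 ^ n

/-- `W_n(q)`: number of tuples `(x_1,…,x_{n-1})` of units mod `q` with
`x_1+⋯+x_{n-1}+1 ≡ 0` and `x_1⁻¹+⋯+x_{n-1}⁻¹+1 ≡ 0 (mod q)`. -/
noncomputable def W (n q : ℕ) : ℕ :=
  Nat.card {x : Fin (n - 1) → (ZMod q)ˣ //
    (∑ i, ((x i : ZMod q))) + 1 = 0 ∧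
    (∑ i, (((x i)⁻¹ : (ZMod q)ˣ) : ZMod q)) + 1 = 0}

section PowerMoment

variable {p : ℕ} [Fact p.Prime]

/-- A Kloosterman sum modulo a prime, written with the standard additive character. -/
theorem Kl_eq_sum_units (u v : ℤ) :
    Kl p u v = ∑ x : (ZMod p)ˣ,
      ZMod.stdAddChar ((u : ZMod p) * (x : ZMod p) + (v : ZMod p) * ((x⁻¹ : (ZMod p)ˣ) : ZMod p)) := by
  have hcast (x : ℕ) : Complex.exp (2 * Real.pi * Complex.I *
        ((u : ℂ) * (x : ℂ) + (v : ℂ) * ((((x : ZMod p)⁻¹ : ZMod p).val : ℕ) : ℂ)) / (p : ℂ)) =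
      ZMod.stdAddChar ((u : ZMod p) * (x : ZMod p) + (v : ZMod p) * (x : ZMod p)⁻¹) := by
    have h := ZMod.stdAddChar_coe (N := p) (u * x + v * ((x : ZMod p)⁻¹).val)
    push_cast [ZMod.natCast_zmod_val] at h
    exact h.symm
  unfold Kl
  simp only [hcast]
  rw [← Finset.sum_filter]
  symm
  refine Finset.sum_bij (fun x _ ↦ (x : ZMod p).val) ?_ ?_ ?_ ?_
  · intro x _
    exact mem_filter.2 ⟨mem_range.2 (ZMod.val_lt _), ZMod.val_coe_unit_coprime x⟩
  · intro x _ y _ h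
    exact Units.ext (ZMod.val_injective p h)
  · intro x hx
    obtain ⟨hlt, hco⟩ := mem_filter.1 hx
    refine ⟨ZMod.unitOfCoprime x hco, mem_univ _, ?_⟩
    rw [ZMod.coe_unitOfCoprime, ZMod.val_cast_of_lt (mem_range.1 hlt)]
  · intro x _
    simp only [ZMod.natCast_zmod_val, ZMod.inv_coe_unit]

/-- The sum over the residues `1, …, p` is the sum over `ℤ/pℤ`. -/
theorem sum_range_natCast_add_one {M : Type*} [AddCommMonoid M] (f : ZMod p → M) :
    ∑ u ∈ range p, f ((u : ZMod p) + 1) = ∑ u, f u := by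
  rw [← Equiv.sum_comp (Equiv.addRight (1 : ZMod p)) f]
  symm
  refine Finset.sum_bij (fun x _ ↦ x.val) ?_ ?_ ?_ ?_
  · exact fun x _ ↦ mem_range.2 (ZMod.val_lt x)
  · exact fun x _ y _ h ↦ ZMod.val_injective p h
  · exact fun x hx ↦ ⟨x, mem_univ _, ZMod.val_cast_of_lt (mem_range.1 hx)⟩
  · intro x _
    simp

theorem sum_stdAddChar_mul (a : ZMod p) :
    ∑ u : ZMod p, (ZMod.stdAddChar (u * a) : ℂ) = if a = 0 then (p : ℂ) else 0 := by
  rw [AddChar.sum_mulShift a (ZMod.isPrimitive_stdAddChar p), ZMod.card]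
  push_cast
  rfl

theorem sum_units_add_zero {M : Type*} [AddCommMonoid M] (f : ZMod p → M) :
    ∑ x : (ZMod p)ˣ, f x + f 0 = ∑ x, f x := by
  rw [← sum_erase_add univ f (mem_univ 0)]
  congr 1
  rw [sum_subtype (univ.erase 0) (p := fun x : ZMod p ↦ x ≠ 0) (by simp)]
  exact (unitsEquivNeZero (G₀ := ZMod p)).sum_comp (fun x ↦ f x.1)

theorem sum_units_stdAddChar_mul (a : ZMod p) :
    ∑ x : (ZMod p)ˣ, (ZMod.stdAddChar ((x : ZMod p) * a) : ℂ) =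
      (if a = 0 then (p : ℂ) else 0) - 1 := by
  rw [← sum_stdAddChar_mul, ← sum_units_add_zero fun x : ZMod p ↦ (ZMod.stdAddChar (x * a) : ℂ)]
  simp

theorem AddChar.map_sum_eq_prod {ι A M : Type*} [AddCommMonoid A] [CommMonoid M]
    (ψ : AddChar A M) (s : Finset ι) (f : ι → A) : ψ (∑ i ∈ s, f i) = ∏ i ∈ s, ψ (f i) := by
  classical
  induction s using Finset.induction_on with
  | empty => simp
  | insert a s ha ih => rw [sum_insert ha, prod_insert ha, AddChar.map_add_eq_mul, ih]

/-- Scaling coordinates `1, …, m` of a tuple by the coordinate `0` permutes `Fin (m + 1) → G`. -/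
theorem sum_cons_mul_left {G M : Type*} [Group G] [Fintype G] [AddCommMonoid M] (m : ℕ)
    (f : (Fin (m + 1) → G) → M) :
    ∑ x, f x = ∑ y : Fin m → G, ∑ c : G, f (Fin.cons c fun i ↦ c * y i) := by
  rw [← (Fin.consEquiv fun _ : Fin (m + 1) ↦ G).sum_comp, Fintype.sum_prod_type]
  conv_rhs => rw [sum_comm]
  refine sum_congr rfl fun c _ ↦ ?_
  exact ((Equiv.piCongrRight fun _ : Fin m ↦ Equiv.mulLeft c).sum_comp
    (fun z ↦ f (Fin.cons c z))).symm

/-- The number of tuples of `m` units modulo `p` with sum `-1`, times `p`. -/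
theorem sum_tuples_sum_add_one_eq_zero (m : ℕ) :
    ∑ y : Fin m → (ZMod p)ˣ, (if (∑ i, (y i : ZMod p)) + 1 = 0 then (p : ℂ) else 0) =
      ((p : ℂ) - 1) ^ m - (-1) ^ m := by
  have hu (u : ZMod p) :
      ∑ y : Fin m → (ZMod p)ˣ, (ZMod.stdAddChar (u * ((∑ i, (y i : ZMod p)) + 1)) : ℂ) =
        ((if u = 0 then (p : ℂ) else 0) - 1) ^ m * ZMod.stdAddChar u := by
    rw [← sum_units_stdAddChar_mul, Fintype.sum_pow, sum_mul]
    refine sum_congr rfl fun y _ ↦ ?_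
    rw [← AddChar.map_sum_eq_prod, ← AddChar.map_add_eq_mul, ← sum_mul]
    ring_nf
  have h0 : ∑ x : (ZMod p)ˣ, (ZMod.stdAddChar (x : ZMod p) : ℂ) = -1 := by
    simpa using sum_units_stdAddChar_mul (p := p) 1
  simp_rw [← sum_stdAddChar_mul]
  rw [sum_comm]
  simp_rw [hu]
  rw [← sum_units_add_zero]
  simp [← mul_sum, h0]
  ring

theorem S_succ_eq_sum_tuples (m : ℕ) :
    S (m + 1) p = ∑ y : Fin m → (ZMod p)ˣ,
      (if (∑ i, (y i : ZMod p)) + 1 = 0 then (p : ℂ) else 0) *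
        ((if (∑ i, (((y i)⁻¹ : (ZMod p)ˣ) : ZMod p)) + 1 = 0 then (p : ℂ) else 0) - 1) := by
  have hS : S (m + 1) p = ∑ u : ZMod p, (∑ x : (ZMod p)ˣ,
      (ZMod.stdAddChar (u * (x : ZMod p) + ((x⁻¹ : (ZMod p)ˣ) : ZMod p)) : ℂ)) ^ (m + 1) := by
    rw [← sum_range_natCast_add_one]
    simp only [S, Kl_eq_sum_units, Int.cast_add, Int.cast_natCast, Int.cast_one, one_mul]
  rw [hS]
  simp_rw [Fintype.sum_pow, ← AddChar.map_sum_eq_prod]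
  rw [sum_comm, sum_cons_mul_left]
  refine sum_congr rfl fun y _ ↦ ?_
  rw [← sum_stdAddChar_mul, ← sum_units_stdAddChar_mul, mul_sum,
    ← Equiv.sum_comp (Equiv.inv (ZMod p)ˣ)]
  refine sum_congr rfl fun c _ ↦ ?_
  rw [sum_mul, ← Equiv.sum_comp (Units.mulRight c)]
  refine sum_congr rfl fun u _ ↦ ?_
  rw [← AddChar.map_add_eq_mul, Fin.sum_univ_succ]
  congr 1
  simp only [Fin.cons_zero, Fin.cons_succ, Equiv.inv_apply, Units.mulRight_apply, inv_inv,
    mul_inv, Units.val_mul, mul_add, sum_add_distrib, mul_assoc, ← mul_sum,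
    Units.mul_inv_cancel_left, Units.mul_inv, mul_one]
  ring

end PowerMoment

/-- For `n ≥ 2` and `p` prime: `S_n(p) = p²·W_n(p) − ((p−1)^(n−1) + (−1)^n)`. -/
theorem power_moment_prime_eq_W (n p : ℕ) (hn : 2 ≤ n) (hp : p.Prime) :
    S n p =
      (p : ℂ) ^ 2 * (W n p : ℂ) - (((p : ℂ) - 1) ^ (n - 1) + (-1 : ℂ) ^ n) := by
  have : Fact p.Prime := ⟨hp⟩
  obtain ⟨m, rfl⟩ : ∃ m, n = m + 1 := ⟨n - 1, by omega⟩
  have hW : (p : ℂ) ^ 2 * (W (m + 1) p : ℂ) = ∑ y : Fin m → (ZMod p)ˣ,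
      (if (∑ i, (y i : ZMod p)) + 1 = 0 then (p : ℂ) else 0) *
        (if (∑ i, (((y i)⁻¹ : (ZMod p)ˣ) : ZMod p)) + 1 = 0 then (p : ℂ) else 0) := by
    simp_rw [ite_zero_mul_ite_zero]
    rw [W, Nat.card_eq_fintype_card, Fintype.card_subtype, ← sum_filter, sum_const, nsmul_eq_mul,
      mul_comm, sq]
    rfl
  rw [S_succ_eq_sum_tuples, hW, Nat.add_sub_cancel]
  simp_rw [mul_sub, mul_one]
  rw [sum_sub_distrib, sum_tuples_sum_add_one_eq_zero]
  ring
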